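/- (Friedgut's Theorem, monotone {1,2,*} version) Fix p ∈ (0,1). There is a constant c_p > 0 depending only on p such that for every δ > 0 and every monotone family 𝔽 ⊆ {1,2,*}^m with average sensitivity a = as_p(𝔽), the family 𝔽 has a (δ,p)-core C ⊆ [m] of size |C| ≤ c_p^{a/δ}. -/

import Mathlib

open Finset

/-- The alphabet `{1, 2, *}`, where `none` stands for `*` and `some j` for the
values `1, 2`. -/
abbrev Star3 := Option (Fin 2)

/-- The weight of a single symbol under the measure `μ_p`: `*` gets `1 - p`,
each of `1` and `2` gets `p/2`. -/
noncomputable def star3Weight (p : ℝ) (a : Star3) : ℝ :=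
  if a = none then 1 - p else p / 2

/-- The product measure `μ_p` of a family `𝔽 ⊆ {1,2,*}^m`. -/
noncomputable def muP (p : ℝ) {m : ℕ} (F : Finset (Fin m → Star3)) : ℝ :=
  ∑ f ∈ F, ∏ i, star3Weight p (f i)

/-- A family is monotone if changing a `*` coordinate of a member to `1` or `2`
again yields a member. -/
def MonotoneFamily {m : ℕ} (F : Finset (Fin m → Star3)) : Prop :=
  ∀ f ∈ F, ∀ i : Fin m, f i = none → ∀ j : Fin 2, Function.update f i (some j) ∈ F

/-- The influence `Inf_i^p(𝔽)`: the `μ_p`-measure of the set of `F` with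
`F|_{i=*} ∉ 𝔽` and `F|_{i=j} ∈ 𝔽` for some `j ∈ {1,2}`. -/
noncomputable def infP (p : ℝ) {m : ℕ} (F : Finset (Fin m → Star3)) (i : Fin m) : ℝ :=
  muP p (Finset.univ.filter (fun f : Fin m → Star3 =>
    Function.update f i none ∉ F ∧ ∃ j : Fin 2, Function.update f i (some j) ∈ F))

/-- The average sensitivity `as_p(𝔽) = Σ_i Inf_i^p(𝔽)`. -/
noncomputable def avgSens (p : ℝ) {m : ℕ} (F : Finset (Fin m → Star3)) : ℝ :=
  ∑ i, infP p F i


/-- A family `𝔽'` depends only on the coordinates in `C`. -/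
def DependsOnlyOn {m : ℕ} (F' : Finset (Fin m → Star3)) (C : Finset (Fin m)) : Prop :=
  ∀ f g : Fin m → Star3, (∀ i ∈ C, f i = g i) → (f ∈ F' ↔ g ∈ F')

/-- `C` is a `(δ,p)`-core of `𝔽`: some family `𝔽'` depending only on the
coordinates in `C` satisfies `μ_p(𝔽 △ 𝔽') ≤ δ`. -/
def IsCore (p δ : ℝ) {m : ℕ} (F : Finset (Fin m → Star3)) (C : Finset (Fin m)) : Prop :=
  ∃ F' : Finset (Fin m → Star3), DependsOnlyOn F' C ∧ muP p ((F \ F') ∪ (F' \ F)) ≤ δ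


/-- An orthonormal basis of the functions on `{1, 2, *}` with respect to the weight
`star3Weight p`, with the constant function `1` at index `0`. -/
noncomputable def star3Basis (p : ℝ) (c : Fin 3) (a : Star3) : ℝ :=
  ![1, a.elim 0 ![1 / √p, -(1 / √p)], a.elim (-(√p / √(1 - p))) fun _ => √(1 - p) / √p] c

/-- The product weight of a point. -/
noncomputable def pointWeight (p : ℝ) {m : ℕ} (x : Fin m → Star3) : ℝ :=
  ∏ i, star3Weight p (x i)

/-- The product basis function with index `s`. -/
noncomputable def prodBasis (p : ℝ) {m : ℕ} (s : Fin m → Fin 3) (x : Fin m → Star3) : ℝ :=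
  ∏ i, star3Basis p (s i) (x i)

/-- The function whose coefficients in the product basis are `c`. -/
noncomputable def synth (p : ℝ) {m : ℕ} (c : (Fin m → Fin 3) → ℝ) (x : Fin m → Star3) : ℝ :=
  ∑ s, c s * prodBasis p s x

/-- The coefficient of `f` at the basis function with index `s`. -/
noncomputable def coeff (p : ℝ) {m : ℕ} (f : (Fin m → Star3) → ℝ) (s : Fin m → Fin 3) : ℝ :=
  ∑ x, pointWeight p x * f x * prodBasis p s x

/-- The number of nonzero entries of an index, as the level of its basis function. -/
def level {m : ℕ} (s : Fin m → Fin 3) : ℕ := ∑ i, if s i = 0 then 0 else 1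

lemma star3Weight_pos {p : ℝ} (hp : p ∈ Set.Ioo (0 : ℝ) 1) (a : Star3) : 0 < star3Weight p a := by
  obtain ⟨h0, h1⟩ := hp
  unfold star3Weight
  split_ifs <;> linarith

lemma sum_star3Weight (p : ℝ) : ∑ a, star3Weight p a = 1 := by
  simp [star3Weight, Fintype.sum_option]
  ring

lemma pointWeight_nonneg {p : ℝ} (hp : p ∈ Set.Ioo (0 : ℝ) 1) {m : ℕ} (x : Fin m → Star3) :
    0 ≤ pointWeight p x :=
  prod_nonneg fun _ _ => (star3Weight_pos hp _).le

lemma sum_pointWeight (p : ℝ) (m : ℕ) : ∑ x : Fin m → Star3, pointWeight p x = 1 := by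
  unfold pointWeight
  rw [← Fintype.prod_sum fun (_ : Fin m) a => star3Weight p a]
  simp only [sum_star3Weight, prod_const_one]

lemma muP_le_one {p : ℝ} (hp : p ∈ Set.Ioo (0 : ℝ) 1) {m : ℕ} (F : Finset (Fin m → Star3)) :
    muP p F ≤ 1 := by
  rw [← sum_pointWeight p m]
  exact sum_le_sum_of_subset_of_nonneg (subset_univ _) fun x _ _ => pointWeight_nonneg hp x

lemma muP_nonneg {p : ℝ} (hp : p ∈ Set.Ioo (0 : ℝ) 1) {m : ℕ} (F : Finset (Fin m → Star3)) :
    0 ≤ muP p F :=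
  sum_nonneg fun x _ => pointWeight_nonneg hp x

lemma star3Basis_zero (p : ℝ) (a : Star3) : star3Basis p 0 a = 1 := by
  simp [star3Basis]

lemma star3Basis_orthonormal {p : ℝ} (hp : p ∈ Set.Ioo (0 : ℝ) 1) (c d : Fin 3) :
    ∑ a, star3Weight p a * (star3Basis p c a * star3Basis p d a) = if c = d then 1 else 0 := by
  obtain ⟨h0, h1⟩ := hp
  obtain ⟨s, hs, rfl⟩ : ∃ s : ℝ, 0 < s ∧ p = s ^ 2 :=
    ⟨√p, Real.sqrt_pos.2 h0, (Real.sq_sqrt h0.le).symm⟩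
  obtain ⟨t, ht, h⟩ : ∃ t : ℝ, 0 < t ∧ 1 - s ^ 2 = t ^ 2 :=
    ⟨√(1 - s ^ 2), Real.sqrt_pos.2 (by linarith), (Real.sq_sqrt (by linarith)).symm⟩
  fin_cases c <;> fin_cases d <;>
    simp [star3Weight, star3Basis, Fintype.sum_option, Fin.sum_univ_two, h, Real.sqrt_sq hs.le,
      Real.sqrt_sq ht.le] <;>
    field_simp <;> grind

lemma star3Basis_complete {p : ℝ} (hp : p ∈ Set.Ioo (0 : ℝ) 1) (a b : Star3) :
    ∑ c, star3Weight p b * (star3Basis p c b * star3Basis p c a) = if b = a then 1 else 0 := by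
  obtain ⟨h0, h1⟩ := hp
  obtain ⟨s, hs, rfl⟩ : ∃ s : ℝ, 0 < s ∧ p = s ^ 2 :=
    ⟨√p, Real.sqrt_pos.2 h0, (Real.sq_sqrt h0.le).symm⟩
  obtain ⟨t, ht, h⟩ : ∃ t : ℝ, 0 < t ∧ 1 - s ^ 2 = t ^ 2 :=
    ⟨√(1 - s ^ 2), Real.sqrt_pos.2 (by linarith), (Real.sq_sqrt (by linarith)).symm⟩
  rcases a with _ | a <;> rcases b with _ | b <;> (try fin_cases a) <;> (try fin_cases b) <;>
    simp [star3Weight, star3Basis, Fin.sum_univ_three, h, Real.sqrt_sq hs.le, Real.sqrt_sq ht.le] <;>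
    field_simp <;> grind

lemma sum_pointWeight_prodBasis {p : ℝ} (hp : p ∈ Set.Ioo (0 : ℝ) 1) {m : ℕ}
    (s t : Fin m → Fin 3) :
    ∑ x, pointWeight p x * (prodBasis p s x * prodBasis p t x) = if s = t then 1 else 0 := by
  simp only [pointWeight, prodBasis, ← prod_mul_distrib]
  rw [← Fintype.prod_sum fun i a =>
    star3Weight p a * (star3Basis p (s i) a * star3Basis p (t i) a)]
  simp only [star3Basis_orthonormal hp, funext_iff]
  rw [Fintype.prod_ite_zero]
  simp

lemma sum_prodBasis_mul {p : ℝ} (hp : p ∈ Set.Ioo (0 : ℝ) 1) {m : ℕ} (x y : Fin m → Star3) :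
    ∑ s, pointWeight p y * (prodBasis p s y * prodBasis p s x) = if y = x then 1 else 0 := by
  simp only [pointWeight, prodBasis, ← prod_mul_distrib]
  rw [← Fintype.prod_sum fun i c =>
    star3Weight p (y i) * (star3Basis p c (y i) * star3Basis p c (x i))]
  simp only [star3Basis_complete hp, funext_iff]
  rw [Fintype.prod_ite_zero]
  simp

/-- Every function is the sum of its expansion in the product basis. -/
lemma synth_coeff {p : ℝ} (hp : p ∈ Set.Ioo (0 : ℝ) 1) {m : ℕ} (f : (Fin m → Star3) → ℝ)
    (x : Fin m → Star3) : synth p (coeff p f) x = f x := by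
  have h : ∀ s, coeff p f s * prodBasis p s x =
      ∑ y, f y * (pointWeight p y * (prodBasis p s y * prodBasis p s x)) := by
    intro s
    rw [coeff, sum_mul]
    exact sum_congr rfl fun y _ => by ring
  simp only [synth, h]
  rw [sum_comm]
  simp [← mul_sum, sum_prodBasis_mul hp]

/-- Parseval's identity. -/
lemma sum_synth_mul_synth {p : ℝ} (hp : p ∈ Set.Ioo (0 : ℝ) 1) {m : ℕ}
    (c d : (Fin m → Fin 3) → ℝ) :
    ∑ x, pointWeight p x * (synth p c x * synth p d x) = ∑ s, c s * d s := by
  have h : ∀ x, pointWeight p x * (synth p c x * synth p d x) =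
      ∑ s, ∑ t, c s * d t * (pointWeight p x * (prodBasis p s x * prodBasis p t x)) := by
    intro x
    rw [synth, synth, sum_mul_sum, mul_sum]
    refine sum_congr rfl fun s _ => ?_
    rw [mul_sum]
    exact sum_congr rfl fun t _ => by ring
  simp only [h]
  rw [sum_comm]
  refine sum_congr rfl fun s _ => ?_
  rw [sum_comm]
  simp [← mul_sum, sum_pointWeight_prodBasis hp]

lemma prodBasis_update (p : ℝ) {m : ℕ} (s : Fin m → Fin 3) (x : Fin m → Star3) (i : Fin m)
    (a : Star3) : prodBasis p s (Function.update x i a) =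
      star3Basis p (s i) a * ∏ j ∈ univ.erase i, star3Basis p (s j) (x j) := by
  rw [prodBasis, ← mul_prod_erase univ _ (mem_univ i), Function.update_self]
  congr 1
  exact prod_congr rfl fun j hj => by rw [Function.update_of_ne (ne_of_mem_erase hj)]

/-- Averaging out a coordinate kills exactly the basis functions depending on it. -/
lemma sum_weight_prodBasis_update {p : ℝ} (hp : p ∈ Set.Ioo (0 : ℝ) 1) {m : ℕ}
    (s : Fin m → Fin 3) (x : Fin m → Star3) (i : Fin m) :
    ∑ a, star3Weight p a * prodBasis p s (Function.update x i a) =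
      if s i = 0 then prodBasis p s x else 0 := by
  have h := star3Basis_orthonormal hp (s i) 0
  simp only [star3Basis_zero, mul_one] at h
  simp only [prodBasis_update, ← mul_assoc, ← sum_mul, h]
  split_ifs with h0
  · rw [prodBasis, ← mul_prod_erase univ _ (mem_univ i), h0, star3Basis_zero]
  · simp

lemma sub_sum_weight_update_eq_synth {p : ℝ} (hp : p ∈ Set.Ioo (0 : ℝ) 1) {m : ℕ}
    (f : (Fin m → Star3) → ℝ) (x : Fin m → Star3) (i : Fin m) :
    f x - ∑ a, star3Weight p a * f (Function.update x i a) =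
      synth p (fun s => if s i = 0 then 0 else coeff p f s) x := by
  have h : ∑ a, star3Weight p a * f (Function.update x i a) =
      ∑ s, coeff p f s * if s i = 0 then prodBasis p s x else 0 := by
    simp_rw [← sum_weight_prodBasis_update hp, ← synth_coeff hp f, synth, mul_sum]
    rw [sum_comm]
    exact sum_congr rfl fun s _ => sum_congr rfl fun a _ => by
      rw [← show synth p (coeff p f) = f from funext (synth_coeff hp f)]; ring
  rw [h]
  nth_rw 1 [← synth_coeff hp f x]
  rw [synth, synth, ← sum_sub_distrib]
  exact sum_congr rfl fun s _ => by split_ifs <;> ring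

lemma sum_univ_fin_cons {α : Type*} [Fintype α] {m : ℕ} (f : (Fin (m + 1) → α) → ℝ) :
    ∑ x, f x = ∑ a, ∑ y : Fin m → α, f (Fin.cons a y) := by
  rw [← Fintype.sum_prod_type' fun a (y : Fin m → α) => f (Fin.cons a y)]
  exact (Fintype.sum_equiv (Fin.consEquiv fun _ => α) _ _ fun _ => rfl).symm

/-- The noise operator on one coordinate contracts from `L²` to `L⁴`. -/
lemma star3_hypercontractive {p ρ : ℝ} (hp : p ∈ Set.Ioo (0 : ℝ) 1)
    (hρ : ∀ a, 4 * ρ ^ 2 ≤ star3Weight p a) (g : Fin 3 → ℝ) :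
    ∑ a, star3Weight p a * (∑ c, ρ ^ (if c = 0 then 0 else 1) * g c * star3Basis p c a) ^ 4 ≤
      (∑ c, g c ^ 2) ^ 2 := by
  set u : Star3 → ℝ := fun a => g 1 * star3Basis p 1 a + g 2 * star3Basis p 2 a with hu
  set v : ℝ := g 1 ^ 2 + g 2 ^ 2 with hv
  have hsum : ∀ a, ∑ c, ρ ^ (if c = 0 then 0 else 1) * g c * star3Basis p c a =
      g 0 + ρ * u a := by
    intro a
    simp [Fin.sum_univ_three, star3Basis_zero, hu]
    ring
  have hmean : ∑ a, star3Weight p a * u a = 0 := by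
    have h1 := star3Basis_orthonormal hp 1 0
    have h2 := star3Basis_orthonormal hp 2 0
    simp only [star3Basis_zero, mul_one, one_ne_zero, if_false,
      show (2 : Fin 3) ≠ 0 by decide] at h1 h2
    calc _ = g 1 * ∑ a, star3Weight p a * star3Basis p 1 a +
          g 2 * ∑ a, star3Weight p a * star3Basis p 2 a := by
          rw [mul_sum, mul_sum, ← sum_add_distrib]
          exact sum_congr rfl fun a _ => by simp only [hu]; ring
      _ = 0 := by rw [h1, h2]; ring
  have hvar : ∑ a, star3Weight p a * u a ^ 2 = v := by
    have h1 := star3Basis_orthonormal hp 1 1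
    have h2 := star3Basis_orthonormal hp 2 2
    have h3 := star3Basis_orthonormal hp 1 2
    simp only [if_true, show (1 : Fin 3) ≠ 2 by decide, if_false] at h1 h2 h3
    calc _ = g 1 ^ 2 * ∑ a, star3Weight p a * (star3Basis p 1 a * star3Basis p 1 a) +
          g 2 ^ 2 * ∑ a, star3Weight p a * (star3Basis p 2 a * star3Basis p 2 a) +
          2 * g 1 * g 2 * ∑ a, star3Weight p a * (star3Basis p 1 a * star3Basis p 2 a) := by
          rw [mul_sum, mul_sum, mul_sum, ← sum_add_distrib, ← sum_add_distrib]
          exact sum_congr rfl fun a _ => by simp only [hu]; ring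
      _ = v := by rw [h1, h2, h3]; ring
  have hw := fun a => (star3Weight_pos hp a).le
  have hv0 : 0 ≤ v := by positivity
  have hρ4 : 4 * ρ ^ 2 ≤ 1 := (hρ none).trans <| (sum_star3Weight p).symm ▸
    single_le_sum (f := star3Weight p) (fun a _ => hw a) (mem_univ none)
  have hpoint : ∀ a, 4 * ρ ^ 2 * u a ^ 2 ≤ v := fun a =>
    (mul_le_mul_of_nonneg_right (hρ a) (sq_nonneg _)).trans <| hvar ▸
      single_le_sum (f := fun a => star3Weight p a * u a ^ 2)
        (fun a _ => mul_nonneg (hw a) (sq_nonneg _)) (mem_univ a)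
  have hbound : ∀ a, star3Weight p a * (g 0 + ρ * u a) ^ 4 ≤ g 0 ^ 4 * star3Weight p a +
      4 * g 0 ^ 3 * ρ * (star3Weight p a * u a) +
      (8 * g 0 ^ 2 * ρ ^ 2 + ρ ^ 2 * v) * (star3Weight p a * u a ^ 2) := by
    intro a
    have h4 : 4 * (ρ * u a) ^ 4 ≤ ρ ^ 2 * v * u a ^ 2 := by
      have := mul_le_mul_of_nonneg_left (hpoint a) (mul_nonneg (sq_nonneg ρ) (sq_nonneg (u a)))
      nlinarith
    have h : (g 0 + ρ * u a) ^ 4 ≤ g 0 ^ 4 + 4 * g 0 ^ 3 * ρ * u a +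
        (8 * g 0 ^ 2 * ρ ^ 2 + ρ ^ 2 * v) * u a ^ 2 := by
      nlinarith [mul_nonneg (sq_nonneg (ρ * u a)) (sq_nonneg (g 0 - ρ * u a)),
        sq_nonneg ((ρ * u a) ^ 2)]
    have := mul_le_mul_of_nonneg_left h (hw a)
    linarith
  simp only [hsum]
  refine (sum_le_sum fun a _ => hbound a).trans ?_
  rw [sum_add_distrib, sum_add_distrib, ← mul_sum, ← mul_sum, ← mul_sum, hmean, hvar,
    sum_star3Weight, Fin.sum_univ_three, add_assoc (g 0 ^ 2), ← hv]
  nlinarith [mul_nonneg (sub_nonneg.2 hρ4) (mul_nonneg (sq_nonneg (g 0)) hv0),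
    mul_nonneg (sub_nonneg.2 hρ4) (mul_nonneg hv0 hv0)]

/-- The noise operator on a product space contracts from `L²` to `L⁴`. -/
lemma synth_hypercontractive {p ρ : ℝ} (hp : p ∈ Set.Ioo (0 : ℝ) 1)
    (hρ : ∀ a, 4 * ρ ^ 2 ≤ star3Weight p a) {m : ℕ} (c : (Fin m → Fin 3) → ℝ) :
    ∑ x, pointWeight p x * synth p (fun s => ρ ^ level s * c s) x ^ 4 ≤ (∑ s, c s ^ 2) ^ 2 := by
  induction m with
  | zero => simp [pointWeight, synth, level, prodBasis, ← pow_mul]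
  | succ m ih =>
    set G : Fin 3 → (Fin m → Star3) → ℝ :=
      fun k => synth p fun s => ρ ^ level s * c (Fin.cons k s) with hG
    have hsplit : ∀ a y, synth p (fun s => ρ ^ level s * c s) (Fin.cons a y) =
        ∑ k, ρ ^ (if k = 0 then 0 else 1) * G k y * star3Basis p k a := by
      intro a y
      rw [synth, sum_univ_fin_cons]
      refine sum_congr rfl fun k _ => ?_
      simp only [hG, synth, mul_sum, sum_mul]
      refine sum_congr rfl fun s _ => ?_
      simp only [level, prodBasis, Fin.sum_univ_succ, Fin.prod_univ_succ, Fin.cons_zero,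
        Fin.cons_succ, pow_add]
      ring
    have hweight : ∀ a (y : Fin m → Star3),
        pointWeight p (Fin.cons a y : Fin (m + 1) → Star3) =
          star3Weight p a * pointWeight p y := by
      intro a y
      simp [pointWeight, Fin.prod_univ_succ]
    have hpair : ∀ k l, ∑ y, pointWeight p y * (G k y ^ 2 * G l y ^ 2) ≤
        (∑ s, c (Fin.cons k s) ^ 2) * ∑ s, c (Fin.cons l s) ^ 2 := by
      intro k l
      refine le_of_sq_le_sq ?_ (by positivity)
      refine (sum_sq_le_sum_mul_sum_of_sq_le_mul univ
        (f := fun y => pointWeight p y * G k y ^ 4) (g := fun y => pointWeight p y * G l y ^ 4)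
        (fun y _ => mul_nonneg (pointWeight_nonneg hp y) (by positivity))
        (fun y _ => mul_nonneg (pointWeight_nonneg hp y) (by positivity))
        fun y _ => le_of_eq (by ring)).trans ?_
      rw [mul_pow]
      exact mul_le_mul (ih _) (ih _)
        (sum_nonneg fun y _ => mul_nonneg (pointWeight_nonneg hp y) (by positivity))
        (by positivity)
    calc _ = ∑ y, pointWeight p y * ∑ a, star3Weight p a *
          (∑ k, ρ ^ (if k = 0 then 0 else 1) * G k y * star3Basis p k a) ^ 4 := by
          rw [sum_univ_fin_cons, sum_comm]
          refine sum_congr rfl fun y _ => ?_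
          rw [mul_sum]
          refine sum_congr rfl fun a _ => ?_
          rw [hsplit, hweight]
          ring
      _ ≤ ∑ y, pointWeight p y * (∑ k, G k y ^ 2) ^ 2 :=
          sum_le_sum fun y _ => mul_le_mul_of_nonneg_left
            (star3_hypercontractive hp hρ fun k => G k y) (pointWeight_nonneg hp y)
      _ = ∑ k, ∑ l, ∑ y, pointWeight p y * (G k y ^ 2 * G l y ^ 2) := by
          simp only [pow_two (∑ k, G k _ ^ 2)]
          simp only [sum_mul_sum]
          simp only [mul_sum]
          rw [sum_comm]
          exact sum_congr rfl fun k _ => sum_comm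
      _ ≤ ∑ k, ∑ l, (∑ s, c (Fin.cons k s) ^ 2) * ∑ s, c (Fin.cons l s) ^ 2 :=
          sum_le_sum fun k _ => sum_le_sum fun l _ => hpair k l
      _ = _ := by rw [← sum_mul_sum, sum_univ_fin_cons, sq]

/-- The set of points at which coordinate `i` is pivotal; its measure is the influence. -/
def pivotal {m : ℕ} (F : Finset (Fin m → Star3)) (i : Fin m) : Finset (Fin m → Star3) :=
  univ.filter fun f => Function.update f i none ∉ F ∧ ∃ j : Fin 2, Function.update f i (some j) ∈ F

/-- The indicator function of a family. -/
def indic {m : ℕ} (F : Finset (Fin m → Star3)) (x : Fin m → Star3) : ℝ := if x ∈ F then 1 else 0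

lemma sum_pointWeight_mul_indic (p : ℝ) {m : ℕ} (F : Finset (Fin m → Star3)) :
    ∑ x, pointWeight p x * indic F x = muP p F := by
  simp [indic, muP, pointWeight]

lemma infP_nonneg {p : ℝ} (hp : p ∈ Set.Ioo (0 : ℝ) 1) {m : ℕ} (F : Finset (Fin m → Star3))
    (i : Fin m) : 0 ≤ infP p F i :=
  muP_nonneg hp _

lemma sq_indic_sub_le {p : ℝ} (hp : p ∈ Set.Ioo (0 : ℝ) 1) {m : ℕ} {F : Finset (Fin m → Star3)}
    (hF : MonotoneFamily F) (i : Fin m) (x : Fin m → Star3) :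
    (indic F x - ∑ a, star3Weight p a * indic F (Function.update x i a)) ^ 2 ≤
      indic (pivotal F i) x := by
  by_cases hx : x ∈ pivotal F i
  · have h0 : 0 ≤ ∑ a, star3Weight p a * indic F (Function.update x i a) :=
      sum_nonneg fun a _ => mul_nonneg (star3Weight_pos hp a).le (by unfold indic; positivity)
    have h1 : ∑ a, star3Weight p a * indic F (Function.update x i a) ≤ 1 := by
      rw [← sum_star3Weight p]
      refine sum_le_sum fun a _ => mul_le_of_le_one_right (star3Weight_pos hp a).le ?_
      unfold indic
      split_ifs <;> norm_num
    rw [show indic (pivotal F i) x = 1 from if_pos hx, sq_le_one_iff_abs_le_one, abs_le]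
    unfold indic at h0 h1 ⊢
    by_cases hxF : x ∈ F
    · rw [if_pos hxF]; constructor <;> linarith
    · rw [if_neg hxF]; constructor <;> linarith
  · have hconst : ∀ a, indic F (Function.update x i a) = indic F (Function.update x i none) := by
      intro a
      rcases a with _ | j
      · rfl
      by_cases h : Function.update x i none ∈ F
      · have := hF _ h i (by simp) j
        rw [Function.update_idem] at this
        simp [indic, h, this]
      · have : Function.update x i (some j) ∉ F := fun hj => hx (by
          simp only [pivotal, mem_filter, mem_univ, true_and]
          exact ⟨h, j, hj⟩)
        simp [indic, h, this]
    have hself := hconst (x i)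
    rw [Function.update_eq_self] at hself
    simp only [hconst, ← sum_mul, sum_star3Weight, hself, one_mul, sub_self, zero_pow two_ne_zero]
    unfold indic
    positivity

lemma sum_coeff_sq_le_infP {p : ℝ} (hp : p ∈ Set.Ioo (0 : ℝ) 1) {m : ℕ}
    {F : Finset (Fin m → Star3)} (hF : MonotoneFamily F) (i : Fin m) :
    ∑ s, (if s i = 0 then 0 else coeff p (indic F) s ^ 2) ≤ infP p F i := by
  have h := sum_synth_mul_synth hp (fun s => if s i = 0 then 0 else coeff p (indic F) s)
    (fun s => if s i = 0 then 0 else coeff p (indic F) s)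
  calc _ = _ := sum_congr rfl fun s _ => by split_ifs <;> ring
    _ = _ := h.symm
    _ ≤ ∑ x, pointWeight p x * indic (pivotal F i) x := by
      refine sum_le_sum fun x _ => mul_le_mul_of_nonneg_left ?_ (pointWeight_nonneg hp x)
      rw [← sq, ← sub_sum_weight_update_eq_synth hp]
      exact sq_indic_sub_le hp hF i x
    _ = _ := sum_pointWeight_mul_indic _ _

/-- The noisy influence of a coordinate is at most the power `3/2` of its influence. -/
lemma sq_noisy_influence_le {p ρ : ℝ} (hp : p ∈ Set.Ioo (0 : ℝ) 1)
    (hρ : ∀ a, 4 * ρ ^ 2 ≤ star3Weight p a) {m : ℕ} {F : Finset (Fin m → Star3)}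
    (hF : MonotoneFamily F) (i : Fin m) :
    (∑ s, ρ ^ (2 * level s) * (if s i = 0 then 0 else coeff p (indic F) s ^ 2)) ^ 2 ≤
      infP p F i ^ 3 := by
  set d : (Fin m → Fin 3) → ℝ := fun s => if s i = 0 then 0 else coeff p (indic F) s with hd
  set Q := ∑ s, ρ ^ (2 * level s) * (if s i = 0 then 0 else coeff p (indic F) s ^ 2) with hQ
  set D := synth p d with hD
  set H := synth p fun s => ρ ^ level s * (ρ ^ level s * d s) with hH
  have hDA : ∀ x, D x ^ 2 ≤ indic (pivotal F i) x := fun x => by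
    rw [hD, ← sub_sum_weight_update_eq_synth hp]
    exact sq_indic_sub_le hp hF i x
  have hinf : ∑ x, pointWeight p x * indic (pivotal F i) x = infP p F i :=
    sum_pointWeight_mul_indic _ _
  have hμ := infP_nonneg hp F i
  have hW := fun x : Fin m → Star3 => pointWeight_nonneg hp x
  have hA0 : ∀ x, 0 ≤ indic (pivotal F i) x := fun x => by unfold indic; positivity
  have hQDH : ∑ x, pointWeight p x * (D x * H x) = Q := by
    rw [hD, hH, sum_synth_mul_synth hp]
    refine sum_congr rfl fun s _ => ?_
    simp only [hd]
    split_ifs <;> ring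
  have hH4 : ∑ x, pointWeight p x * H x ^ 4 ≤ Q ^ 2 := by
    refine (synth_hypercontractive hp hρ _).trans_eq ?_
    congr 1
    refine sum_congr rfl fun s _ => ?_
    simp only [hd]
    split_ifs <;> ring
  have hfirst : Q ^ 2 ≤ infP p F i * ∑ x, pointWeight p x * (D x ^ 2 * H x ^ 2) := by
    rw [← hQDH, ← hinf]
    refine sum_sq_le_sum_mul_sum_of_sq_le_mul univ (fun x _ => mul_nonneg (hW x) (hA0 x))
      (fun x _ => mul_nonneg (hW x) (by positivity)) fun x _ => ?_
    have := hDA x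
    unfold indic at this ⊢
    split_ifs at this ⊢
    · exact le_of_eq (by ring)
    · have h0 : D x = 0 := by nlinarith [sq_nonneg (D x)]
      simp [h0]
  have hsecond : (∑ x, pointWeight p x * (D x ^ 2 * H x ^ 2)) ^ 2 ≤ infP p F i * Q ^ 2 := by
    refine (sum_sq_le_sum_mul_sum_of_sq_le_mul univ (f := fun x => pointWeight p x * D x ^ 4)
      (g := fun x => pointWeight p x * H x ^ 4) (fun x _ => mul_nonneg (hW x) (by positivity))
      (fun x _ => mul_nonneg (hW x) (by positivity)) fun x _ => le_of_eq (by ring)).trans ?_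
    refine mul_le_mul ?_ hH4 (sum_nonneg fun x _ => mul_nonneg (hW x) (by positivity)) hμ
    rw [← hinf]
    refine sum_le_sum fun x _ => mul_le_mul_of_nonneg_left ?_ (hW x)
    have h1 : indic (pivotal F i) x ≤ 1 := by
      unfold indic
      split_ifs <;> norm_num
    nlinarith [hDA x, sq_nonneg (D x)]
  have hQ4 : Q ^ 2 * Q ^ 2 ≤ infP p F i ^ 3 * Q ^ 2 :=
    calc Q ^ 2 * Q ^ 2 ≤ (infP p F i * ∑ x, pointWeight p x * (D x ^ 2 * H x ^ 2)) *
          (infP p F i * ∑ x, pointWeight p x * (D x ^ 2 * H x ^ 2)) :=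
          mul_self_le_mul_self (sq_nonneg Q) hfirst
      _ = infP p F i ^ 2 * (∑ x, pointWeight p x * (D x ^ 2 * H x ^ 2)) ^ 2 := by ring
      _ ≤ infP p F i ^ 2 * (infP p F i * Q ^ 2) :=
          mul_le_mul_of_nonneg_left hsecond (sq_nonneg _)
      _ = _ := by ring
  rcases eq_or_ne Q 0 with h | h
  · rw [h, zero_pow two_ne_zero]
    positivity
  · exact le_of_mul_le_mul_right hQ4 (by positivity)

open Classical in
/-- If the coefficients not supported in `C` have small total weight, then `C` is a core. -/
lemma isCore_of_tail_le {p δ : ℝ} (hp : p ∈ Set.Ioo (0 : ℝ) 1) {m : ℕ}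
    (F : Finset (Fin m → Star3)) (C : Finset (Fin m))
    (h : 4 * ∑ s, (if ∃ i ∉ C, s i ≠ 0 then coeff p (indic F) s ^ 2 else 0) ≤ δ) :
    IsCore p δ F C := by
  set c := coeff p (indic F) with hc
  set g := synth p fun s => if ∃ i ∉ C, s i ≠ 0 then 0 else c s with hg
  set r := synth p fun s => if ∃ i ∉ C, s i ≠ 0 then c s else 0 with hr
  have hsum : ∀ x, indic F x = g x + r x := by
    intro x
    rw [← synth_coeff hp (indic F) x, hg, hr, synth, synth, synth, ← sum_add_distrib]
    exact sum_congr rfl fun s _ => by split_ifs <;> simp [hc]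
  refine ⟨univ.filter fun x => 1 / 2 ≤ g x, ?_, ?_⟩
  · intro x y hxy
    have : g x = g y := by
      refine sum_congr rfl fun s _ => ?_
      beta_reduce
      split_ifs with hs
      · simp
      · push Not at hs
        congr 1
        refine prod_congr rfl fun i _ => ?_
        by_cases hi : i ∈ C
        · rw [hxy i hi]
        · rw [hs i hi, star3Basis_zero, star3Basis_zero]
    simp [this]
  · refine le_trans ?_ h
    rw [← sum_pointWeight_mul_indic]
    calc _ ≤ ∑ x, 4 * (pointWeight p x * (r x * r x)) := by
          refine sum_le_sum fun x _ => ?_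
          have hW := pointWeight_nonneg hp x
          have hx := hsum x
          suffices indic ((F \ univ.filter fun x => 1 / 2 ≤ g x) ∪
              ((univ.filter fun x => 1 / 2 ≤ g x) \ F)) x ≤ 4 * (r x * r x) by
            nlinarith
          unfold indic at hx ⊢
          by_cases hxF : x ∈ F <;> by_cases hxg : 1 / 2 ≤ g x <;>
            simp only [hxF, hxg, mem_union, mem_sdiff, mem_filter, mem_univ, if_true,
              if_false, not_true, not_false_iff, or_false, false_or, and_true, and_false,
              or_self] at hx ⊢ <;> nlinarith
      _ = 4 * ∑ s, (if ∃ i ∉ C, s i ≠ 0 then c s ^ 2 else 0) := by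
          rw [← mul_sum, hr, sum_synth_mul_synth hp]
          congr 1
          exact sum_congr rfl fun s _ => by split_ifs <;> ring

lemma sum_level_mul_coeff_sq_le {p : ℝ} (hp : p ∈ Set.Ioo (0 : ℝ) 1) {m : ℕ}
    {F : Finset (Fin m → Star3)} (hF : MonotoneFamily F) :
    ∑ s, level s * coeff p (indic F) s ^ 2 ≤ avgSens p F := by
  calc _ = ∑ i, ∑ s, (if s i = 0 then 0 else coeff p (indic F) s ^ 2) := by
        rw [sum_comm]
        refine sum_congr rfl fun s _ => ?_
        rw [level, Nat.cast_sum, sum_mul]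
        exact sum_congr rfl fun i _ => by split_ifs <;> simp
    _ ≤ _ := sum_le_sum fun i _ => sum_coeff_sq_le_infP hp hF i

lemma one_le_level {m : ℕ} {s : Fin m → Fin 3} {i : Fin m} (h : s i ≠ 0) : 1 ≤ level s := by
  have := single_le_sum (f := fun j => if s j = 0 then 0 else 1) (fun _ _ => Nat.zero_le _)
    (mem_univ i)
  simpa [h, level] using this

open Classical in
lemma tail_le_avgSens {p : ℝ} (hp : p ∈ Set.Ioo (0 : ℝ) 1) {m : ℕ}
    {F : Finset (Fin m → Star3)} (hF : MonotoneFamily F) (C : Finset (Fin m)) :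
    ∑ s, (if ∃ i ∉ C, s i ≠ 0 then coeff p (indic F) s ^ 2 else 0) ≤ avgSens p F := by
  refine (sum_le_sum fun s _ => ?_).trans (sum_level_mul_coeff_sq_le hp hF)
  split_ifs with h
  · obtain ⟨i, -, hi⟩ := h
    exact le_mul_of_one_le_left (sq_nonneg _) (by exact_mod_cast one_le_level hi)
  · positivity

open Classical in
/-- The weight of the coefficients not supported on a set containing all influential coordinates. -/
lemma tail_le_of_infP_le {p ρ σ : ℝ} (hp : p ∈ Set.Ioo (0 : ℝ) 1) (hρ0 : 0 < ρ) (hρ1 : ρ ≤ 1)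
    (hρ : ∀ a, 4 * ρ ^ 2 ≤ star3Weight p a) (hσ : 0 ≤ σ) {m : ℕ} {F : Finset (Fin m → Star3)}
    (hF : MonotoneFamily F) {C : Finset (Fin m)} (hC : ∀ i ∉ C, infP p F i ≤ σ ^ 2) {k : ℕ}
    (hk : 0 < k) :
    ∑ s, (if ∃ i ∉ C, s i ≠ 0 then coeff p (indic F) s ^ 2 else 0) ≤
      avgSens p F / k + (ρ ^ (2 * k))⁻¹ * (σ * avgSens p F) := by
  set c := coeff p (indic F) with hc
  have hk' : (0 : ℝ) < k := by exact_mod_cast hk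
  have hnoise : ∑ i ∈ Cᶜ, ∑ s, ρ ^ (2 * level s) * (if s i = 0 then 0 else c s ^ 2) ≤
      σ * avgSens p F := by
    calc _ ≤ ∑ i ∈ Cᶜ, σ * infP p F i := by
          refine sum_le_sum fun i hi => le_of_sq_le_sq ?_ (mul_nonneg hσ (infP_nonneg hp F i))
          refine (sq_noisy_influence_le hp hρ hF i).trans ?_
          have := mul_le_mul_of_nonneg_right (hC i (mem_compl.1 hi)) (sq_nonneg (infP p F i))
          linarith
      _ ≤ ∑ i, σ * infP p F i := sum_le_sum_of_subset_of_nonneg (subset_univ _)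
          fun i _ _ => mul_nonneg hσ (infP_nonneg hp F i)
      _ = _ := by rw [avgSens, mul_sum]
  have hpoint : ∀ s, (if ∃ i ∉ C, s i ≠ 0 then c s ^ 2 else 0) ≤ level s * c s ^ 2 / k +
      (ρ ^ (2 * k))⁻¹ * ∑ i ∈ Cᶜ, ρ ^ (2 * level s) * (if s i = 0 then 0 else c s ^ 2) := by
    intro s
    have hnn : ∀ i, 0 ≤ ρ ^ (2 * level s) * (if s i = 0 then 0 else c s ^ 2) :=
      fun i => by positivity
    have hnn' := sum_nonneg fun i (_ : i ∈ Cᶜ) => hnn i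
    split_ifs with h
    · obtain ⟨i, hiC, hi⟩ := h
      rcases le_total k (level s) with hks | hks
      · refine le_add_of_le_of_nonneg ?_ (by positivity)
        rw [le_div_iff₀ hk', mul_comm]
        exact mul_le_mul_of_nonneg_right (by exact_mod_cast hks) (sq_nonneg _)
      · refine le_add_of_nonneg_of_le (by positivity) ?_
        rw [inv_mul_eq_div, le_div_iff₀ (by positivity), mul_comm]
        refine le_trans ?_ (single_le_sum (fun i _ => hnn i) (mem_compl.2 hiC))
        rw [if_neg hi]
        exact mul_le_mul_of_nonneg_right
          (pow_le_pow_of_le_one hρ0.le hρ1 (by omega)) (sq_nonneg _)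
    · positivity
  refine (sum_le_sum fun s _ => hpoint s).trans ?_
  rw [sum_add_distrib, ← sum_div, ← mul_sum, sum_comm]
  have := sum_level_mul_coeff_sq_le hp hF
  gcongr

lemma exists_noise_rate {p : ℝ} (hp : p ∈ Set.Ioo (0 : ℝ) 1) :
    ∃ ρ : ℝ, 0 < ρ ∧ ρ ≤ 1 ∧ ∀ a, 4 * ρ ^ 2 ≤ star3Weight p a := by
  obtain ⟨h0, h1⟩ := hp
  have hq : 0 < 1 - p := by linarith
  refine ⟨p * (1 - p) / 2, by positivity, by nlinarith, fun a => ?_⟩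
  have hpq : 4 * (p * (1 - p) / 2) ^ 2 = p * p * ((1 - p) * (1 - p)) := by ring
  have hbound : p * (1 - p) ≤ 1 / 2 := by nlinarith [sq_nonneg (p - 1 / 2)]
  have hprod : 0 < p * (1 - p) := by positivity
  unfold star3Weight
  split_ifs <;> nlinarith

/-- (Friedgut's Theorem, monotone `{1,2,*}` version) For every `p ∈ (0,1)` there
is a constant `c_p > 0` such that every monotone family `𝔽 ⊆ {1,2,*}^m` with
average sensitivity `a = as_p(𝔽)` has a `(δ,p)`-core of size at most
`c_p^{a/δ}`, for every `δ > 0`. -/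
theorem friedgut_monotone_star3 (p : ℝ) (hp : p ∈ Set.Ioo (0 : ℝ) 1) :
    ∃ c : ℝ, 0 < c ∧ ∀ δ : ℝ, 0 < δ → ∀ m : ℕ, ∀ F : Finset (Fin m → Star3),
      MonotoneFamily F →
      ∃ C : Finset (Fin m), IsCore p δ F C ∧
        (C.card : ℝ) ≤ c ^ (avgSens p F / δ) := by
  obtain ⟨ρ, hρ0, hρ1, hρ⟩ := exists_noise_rate hp
  refine ⟨Real.exp 12 * (ρ ^ 48)⁻¹, by positivity, fun δ hδ m F hF => ?_⟩
  set a := avgSens p F with ha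
  have ha0 : 0 ≤ a := sum_nonneg fun i _ => infP_nonneg hp F i
  rcases le_or_gt 1 δ with hδ1 | hδ1
  · refine ⟨∅, ⟨∅, fun f g _ => by simp, (muP_le_one hp _).trans hδ1⟩, ?_⟩
    rw [card_empty, Nat.cast_zero]
    positivity
  rcases le_or_gt (4 * a) δ with haδ | haδ
  · refine ⟨∅, isCore_of_tail_le hp F ∅ ?_, ?_⟩
    · have := tail_le_avgSens hp hF ∅
      linarith
    · rw [card_empty, Nat.cast_zero]
      positivity
  set r := a / δ with hr
  have har : a = r * δ := by rw [hr]; field_simp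
  have hr4 : 1 < 4 * r := by rw [hr, ← mul_div_assoc, lt_div_iff₀ hδ]; linarith
  have hr0 : 0 < r := by linarith
  set k := ⌈8 * r⌉₊ with hk
  have hk1 : 8 * r ≤ k := Nat.le_ceil _
  have hk2 : (k : ℝ) ≤ 12 * r := by
    have := Nat.ceil_lt_add_one (show 0 ≤ 8 * r by positivity)
    linarith
  have hk0 : 0 < k := Nat.ceil_pos.2 (by positivity)
  have hk0' : (0 : ℝ) < k := by exact_mod_cast hk0
  set σ := ρ ^ (2 * k) / (8 * r) with hσ
  have hσ0 : 0 < σ := by positivity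
  refine ⟨univ.filter fun i => σ ^ 2 < infP p F i, isCore_of_tail_le hp F _ ?_, ?_⟩
  · have h := tail_le_of_infP_le hp hρ0 hρ1 hρ hσ0.le hF
      (C := univ.filter fun i => σ ^ 2 < infP p F i) (by simp) hk0
    have h1 : a / k ≤ δ / 8 := by
      rw [div_le_div_iff₀ hk0' (by norm_num), har]
      nlinarith
    have h2 : (ρ ^ (2 * k))⁻¹ * (σ * a) = δ / 8 := by
      rw [hσ, har]
      field_simp
    linarith
  · have hcard : ((univ.filter fun i => σ ^ 2 < infP p F i).card : ℝ) * σ ^ 2 ≤ a := by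
      rw [← nsmul_eq_mul]
      refine (card_nsmul_le_sum _ (infP p F) _ fun i hi => (mem_filter.1 hi).2.le).trans ?_
      exact sum_le_sum_of_subset_of_nonneg (subset_univ _) fun i _ _ => infP_nonneg hp F i
    have hcube : (4 * r) ^ 3 ≤ Real.exp (12 * r) := by
      have h := Real.add_one_le_exp (4 * r)
      calc (4 * r) ^ 3 ≤ Real.exp (4 * r) ^ 3 := by gcongr; linarith
        _ = _ := by rw [← Real.exp_nat_mul]; congr 1; push_cast; ring
    have hpow : (ρ ^ (4 * k))⁻¹ ≤ ((ρ ^ 48)⁻¹) ^ r := by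
      rw [Real.inv_rpow (by positivity), ← Real.rpow_natCast ρ 48, ← Real.rpow_mul hρ0.le,
        ← Real.rpow_natCast ρ (4 * k)]
      refine inv_anti₀ (Real.rpow_pos_of_pos hρ0 _)
        (Real.rpow_le_rpow_of_exponent_ge hρ0 hρ1 ?_)
      push_cast
      linarith
    calc _ ≤ a / σ ^ 2 := (le_div_iff₀ (by positivity)).2 hcard
      _ = 64 * r ^ 3 * δ * (ρ ^ (4 * k))⁻¹ := by
          rw [hσ, har, show 4 * k = 2 * k * 2 by ring, pow_mul ρ (2 * k) 2]
          field_simp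
          norm_num
      _ ≤ (4 * r) ^ 3 * (ρ ^ (4 * k))⁻¹ := by
          refine mul_le_mul_of_nonneg_right ?_ (by positivity)
          nlinarith [pow_pos hr0 3]
      _ ≤ Real.exp (12 * r) * ((ρ ^ 48)⁻¹) ^ r := by gcongr
      _ = _ := by rw [Real.mul_rpow (by positivity) (by positivity), ← Real.exp_mul]
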